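/- arXiv:2512.16875 — 4 statements merged into one kernel-verified Lean document; each statement's English description precedes it below -/
import Mathlib

section
/- Let d, n be positive integers, let P be a d×d real symmetric positive definite matrix, let b_1, …, b_n ∈ ℝ^d be unit vectors (‖b_i‖₂ = 1), and let w_1, …, w_n > 0 be weights such that ∑_{i=1}^n w_i b_i b_iᵀ = I_d. Then log det(P) ≤ ∑_{i=1}^n w_i · log(b_iᵀ P b_i). -/
open Matrix Real

/-- The quadratic form of `U * diagonal l * Uᵀ` in the coordinates given by the columns of `U`. -/
lemma dotProduct_mul_diagonal_mul_transpose_mulVec {m : Type*} [Fintype m] [DecidableEq m]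
    (U : Matrix m m ℝ) (l v : m → ℝ) :
    v ⬝ᵥ ((U * diagonal l * Uᵀ) *ᵥ v) = ∑ j, (Uᵀ *ᵥ v) j ^ 2 * l j := by
  rw [mul_assoc, ← mulVec_mulVec, ← mulVec_mulVec, dotProduct_mulVec, ← mulVec_transpose]
  simp only [dotProduct, mulVec_diagonal]
  exact Finset.sum_congr rfl fun j _ => by ring

/-- The columns of an orthogonal matrix have unit mass against a tight frame. -/
lemma sum_mul_sq_transpose_mulVec_eq_one {ι m : Type*} [Fintype ι] [Fintype m] [DecidableEq m]
    {U : Matrix m m ℝ} (hU : Uᵀ * U = 1) {b : ι → m → ℝ} {w : ι → ℝ}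
    (hframe : ∑ i, w i • vecMulVec (b i) (b i) = 1) (j : m) :
    ∑ i, w i * (Uᵀ *ᵥ b i) j ^ 2 = 1 := by
  have h : Uᵀ * (∑ i, w i • vecMulVec (b i) (b i)) * U = 1 := by
    rw [hframe, mul_one, hU]
  have hj := congrFun (congrFun h j) j
  simp only [Finset.mul_sum, Finset.sum_mul, Matrix.sum_apply, Matrix.mul_smul, Matrix.smul_mul,
    mul_vecMulVec, vecMulVec_mul, ← mulVec_transpose, Matrix.smul_apply, vecMulVec_apply,
    smul_eq_mul, one_apply_eq] at hj
  simpa only [sq] using hj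

/-- **Geometric Brascamp–Lieb inequality** (Claim 1.5).
If `P` is a `d × d` real symmetric positive definite matrix, `b 1, …, b n` are unit
vectors in `ℝ^d`, and `w 1, …, w n > 0` are weights with `∑ i, w i • b i b iᵀ = I`,
then `log det P ≤ ∑ i, w i * log (b iᵀ P b i)`. -/
theorem geometric_brascamp_lieb
    (d n : ℕ) (hd : 0 < d) (hn : 0 < n)
    (P : Matrix (Fin d) (Fin d) ℝ) (hP : P.PosDef)
    (b : Fin n → Fin d → ℝ) (hb : ∀ i, b i ⬝ᵥ b i = 1)
    (w : Fin n → ℝ) (hw : ∀ i, 0 < w i)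
    (hframe : ∑ i, w i • Matrix.vecMulVec (b i) (b i) = (1 : Matrix (Fin d) (Fin d) ℝ)) :
    Real.log P.det ≤ ∑ i, w i * Real.log (b i ⬝ᵥ (P *ᵥ b i)) := by
  have hev : ∀ j, 0 < hP.1.eigenvalues j := hP.eigenvalues_pos
  have hdet : P.det = ∏ j, hP.1.eigenvalues j := by simpa using hP.1.det_eq_prod_eigenvalues
  obtain ⟨U, hU, hU', hPU⟩ : ∃ U : Matrix (Fin d) (Fin d) ℝ, Uᵀ * U = 1 ∧ U * Uᵀ = 1 ∧
      P = U * diagonal hP.1.eigenvalues * Uᵀ :=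
    ⟨hP.1.eigenvectorUnitary, Unitary.coe_star_mul_self hP.1.eigenvectorUnitary,
      Unitary.coe_mul_star_self hP.1.eigenvectorUnitary,
      hP.1.spectral_theorem.trans (Unitary.conjStarAlgAut_apply _ _)⟩
  generalize hP.1.eigenvalues = l at hev hdet hPU
  have hsq : ∀ i, ∑ j, (Uᵀ *ᵥ b i) j ^ 2 = 1 := fun i => by
    have h := dotProduct_mul_diagonal_mul_transpose_mulVec U (fun _ => 1) (b i)
    simpa only [diagonal_one, mul_one, hU', one_mulVec, hb, eq_comm] using h
  have hlog : ∀ i, ∑ j, (Uᵀ *ᵥ b i) j ^ 2 * log (l j) ≤ log (b i ⬝ᵥ (P *ᵥ b i)) := fun i => by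
    rw [hPU, dotProduct_mul_diagonal_mul_transpose_mulVec]
    exact strictConcaveOn_log_Ioi.concaveOn.le_map_sum (fun j _ => sq_nonneg _) (hsq i)
      fun j _ => hev j
  calc log P.det = ∑ j, log (l j) := by rw [hdet, log_prod fun j _ => (hev j).ne']
    _ = ∑ j, (∑ i, w i * (Uᵀ *ᵥ b i) j ^ 2) * log (l j) := by
      simp only [sum_mul_sq_transpose_mulVec_eq_one hU hframe, one_mul]
    _ = ∑ i, w i * ∑ j, (Uᵀ *ᵥ b i) j ^ 2 * log (l j) := by
      simp only [Finset.sum_mul, Finset.mul_sum, mul_assoc]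
      exact Finset.sum_comm
    _ ≤ ∑ i, w i * log (b i ⬝ᵥ (P *ᵥ b i)) :=
      Finset.sum_le_sum fun i _ => mul_le_mul_of_nonneg_left (hlog i) (hw i).le
end

section
/- Let d, n be positive integers, β ≥ 1, and γ ≥ 0. Let a_1, …, a_n ∈ ℝ^d and c* ∈ ℝ^d satisfy ‖a_i − c*‖₂ ≤ 4β for all i. Let ã_i = (a_i, 1) ∈ ℝ^{d+1}, let w_1, …, w_n ≥ 0 with ∑_i w_i = d+1, set M̂ = ∑_i w_i ã_i ã_iᵀ, assume M̂ is positive definite, and assume the complementary slackness condition: ã_iᵀ M̂⁻¹ ã_i = 1 for every i with w_i > 0. Let c = (1/(d+1)) ∑_i w_i a_i and M = ∑_i w_i (a_i − c)(a_i − c)ᵀ. Let S be a d×d symmetric positive definite matrix with S⁻¹ ⪯ I_d, call index i an inlier if (a_i − c*)ᵀ S⁻¹ (a_i − c*) ≤ d/(d+1) and an outlier otherwise, and suppose the total weight on outliers satisfies ∑_{i outlier} w_i ≤ γ(d+1). Then log det(M) ≤ log det(S) + γ(d+1)·log(17β²). -/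
open Matrix Real Finset

theorem Matrix.mul_sum_smul_vecMulVec_mul_transpose {ι l m : Type*} [Fintype ι] [Fintype m]
    (P : Matrix l m ℝ) (w : ι → ℝ) (v : ι → m → ℝ) :
    P * (∑ i, w i • vecMulVec (v i) (v i)) * Pᵀ =
      ∑ i, w i • vecMulVec (P *ᵥ v i) (P *ᵥ v i) := by
  simp only [Matrix.mul_sum, Matrix.sum_mul, Matrix.mul_smul, Matrix.smul_mul, mul_vecMulVec,
    vecMulVec_mul, vecMul_transpose]

/-- Jensen's inequality for `log det` against a weighted resolution of the identity by unit
vectors. -/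
theorem Matrix.PosDef.log_det_le_sum_of_isotropic {ι m : Type*} [Fintype ι] [Fintype m]
    [DecidableEq m] {N : Matrix m m ℝ} (hN : N.PosDef) {w : ι → ℝ} (hw : ∀ i, 0 ≤ w i)
    {v : ι → m → ℝ} (hv : ∀ i, 0 < w i → v i ⬝ᵥ v i = 1)
    (hsum : ∑ i, w i • vecMulVec (v i) (v i) = 1) :
    log N.det ≤ ∑ i, w i * log (v i ⬝ᵥ (N *ᵥ v i)) := by
  set U : Matrix m m ℝ := (hN.isHermitian.eigenvectorUnitary).1
  set l := hN.isHermitian.eigenvalues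
  have hlpos : ∀ j, 0 < l j := hN.eigenvalues_pos
  have hUU : U * Uᵀ = 1 := by
    simpa [star_eq_conjTranspose] using
      Unitary.coe_mul_star_self hN.isHermitian.eigenvectorUnitary
  have hUU' : Uᵀ * U = 1 := mul_eq_one_comm.mp hUU
  have hspec : N = U * diagonal l * Uᵀ := by
    have := hN.isHermitian.spectral_theorem
    rw [Unitary.conjStarAlgAut_apply] at this
    simpa [star_eq_conjTranspose, Function.comp_def] using this
  have hquad : ∀ i, v i ⬝ᵥ (N *ᵥ v i) = ∑ j, (Uᵀ *ᵥ v i) j ^ 2 * l j := by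
    intro i
    rw [hspec, ← mulVec_mulVec, ← mulVec_mulVec, dotProduct_mulVec, ← mulVec_transpose]
    simp only [dotProduct, mulVec_diagonal]
    exact sum_congr rfl fun j _ => by ring
  have hnorm : ∀ i, 0 < w i → ∑ j, (Uᵀ *ᵥ v i) j ^ 2 = 1 := by
    intro i hi
    rw [← hv i hi]
    calc ∑ j, (Uᵀ *ᵥ v i) j ^ 2 = (Uᵀ *ᵥ v i) ⬝ᵥ (Uᵀ *ᵥ v i) := by
          simp only [dotProduct, sq]
      _ = v i ⬝ᵥ v i := by
          rw [dotProduct_mulVec, vecMul_transpose, mulVec_mulVec, hUU, one_mulVec]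
  have hcol : ∀ j, ∑ i, w i * (Uᵀ *ᵥ v i) j ^ 2 = 1 := by
    intro j
    have h : ∑ i, w i • vecMulVec (Uᵀ *ᵥ v i) (Uᵀ *ᵥ v i) = (1 : Matrix m m ℝ) := by
      rw [← mul_sum_smul_vecMulVec_mul_transpose, hsum, Matrix.mul_one, transpose_transpose, hUU']
    simpa [Matrix.sum_apply, vecMulVec_apply, sq] using congrFun (congrFun h j) j
  have hdet : log N.det = ∑ j, log (l j) := by
    rw [hN.isHermitian.det_eq_prod_eigenvalues]
    simp only [RCLike.ofReal_real_eq_id, id_eq]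
    exact log_prod fun j _ => (hlpos j).ne'
  calc log N.det = ∑ j, (∑ i, w i * (Uᵀ *ᵥ v i) j ^ 2) * log (l j) := by
        rw [hdet]; simp only [hcol, one_mul]
    _ = ∑ i, w i * ∑ j, (Uᵀ *ᵥ v i) j ^ 2 * log (l j) := by
        simp only [sum_mul, mul_sum, mul_assoc]
        exact sum_comm
    _ ≤ ∑ i, w i * log (v i ⬝ᵥ (N *ᵥ v i)) := by
        refine sum_le_sum fun i _ => ?_
        rcases (hw i).eq_or_lt with h0 | hpos
        · simp [← h0]
        · refine mul_le_mul_of_nonneg_left ?_ (hw i)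
          rw [hquad]
          simpa using strictConcaveOn_log_Ioi.concaveOn.le_map_sum
            (t := univ) (w := fun j => (Uᵀ *ᵥ v i) j ^ 2) (p := l)
            (fun j _ => sq_nonneg _) (hnorm i hpos) (fun j _ => hlpos j)

open scoped MatrixOrder Matrix.Norms.L2Operator in
theorem Matrix.PosDef.exists_isUnit_transpose_mul_self {m : Type*} [Fintype m] [DecidableEq m]
    {A : Matrix m m ℝ} (hA : A.PosDef) : ∃ B : Matrix m m ℝ, IsUnit B ∧ A = Bᵀ * B := by
  obtain ⟨B, hB, h⟩ := CStarAlgebra.isStrictlyPositive_iff_eq_star_mul_self.mp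
    hA.isStrictlyPositive
  exact ⟨B, hB, by simpa [star_eq_conjTranspose] using h⟩

/-- Weak duality for D-optimal designs: a design `A` satisfying complementary slackness is compared
with an arbitrary ellipsoid `{x | xᵀ Q x ≤ 1}`. -/
theorem Matrix.PosDef.log_det_add_log_det_le_sum {ι m : Type*} [Fintype ι] [Fintype m]
    [DecidableEq m] {A Q : Matrix m m ℝ} (hA : A.PosDef) (hQ : Q.PosDef) {w : ι → ℝ}
    (hw : ∀ i, 0 ≤ w i) {u : ι → m → ℝ} (hAu : A = ∑ i, w i • vecMulVec (u i) (u i))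
    (hu : ∀ i, 0 < w i → u i ⬝ᵥ (A⁻¹ *ᵥ u i) = 1) :
    log A.det + log Q.det ≤ ∑ i, w i * log (u i ⬝ᵥ (Q *ᵥ u i)) := by
  obtain ⟨B, hB, hAB⟩ := hA.exists_isUnit_transpose_mul_self
  have hBdet : IsUnit B.det := (isUnit_iff_isUnit_det B).mp hB
  have hBt : IsUnit Bᵀ.det := by rwa [det_transpose]
  have hN : (B * Q * Bᵀ).PosDef := by
    have := hQ.mul_mul_conjTranspose_same (B := B) (vecMul_injective_of_isUnit hB)
    simpa using this
  have hdet : (B * Q * Bᵀ).det = A.det * Q.det := by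
    rw [hAB]; simp only [det_mul, det_transpose]; ring
  have hback : ∀ i, Bᵀ *ᵥ (Bᵀ⁻¹ *ᵥ u i) = u i := fun i => by
    rw [mulVec_mulVec, mul_nonsing_inv _ hBt, one_mulVec]
  have key := hN.log_det_le_sum_of_isotropic hw (v := fun i => Bᵀ⁻¹ *ᵥ u i)
    (fun i hi => by
      rw [← hu i hi, hAB, mul_inv_rev, ← mulVec_mulVec, dotProduct_mulVec (u i),
        ← mulVec_transpose, transpose_nonsing_inv])
    (by
      calc ∑ i, w i • vecMulVec (Bᵀ⁻¹ *ᵥ u i) (Bᵀ⁻¹ *ᵥ u i)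
          = Bᵀ⁻¹ * A * B⁻¹ := by
            rw [← mul_sum_smul_vecMulVec_mul_transpose, ← hAu, ← transpose_nonsing_inv,
              transpose_transpose]
        _ = 1 := by
            rw [hAB, nonsing_inv_mul_cancel_left _ _ hBt, mul_nonsing_inv _ hBdet])
  rw [hdet, log_mul hA.det_pos.ne' hQ.det_pos.ne'] at key
  refine key.trans_eq (sum_congr rfl fun i _ => ?_)
  congr 2
  rw [← mulVec_mulVec, ← mulVec_mulVec, hback, dotProduct_mulVec, ← mulVec_transpose, hback]

/-- The shear of `ℝᵐ × ℝ` that acts on the slice at height one as translation by `x`. -/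
def shear {m : Type*} [DecidableEq m] (x : m → ℝ) : Matrix (m ⊕ Fin 1) (m ⊕ Fin 1) ℝ :=
  fromBlocks 1 (replicateCol (Fin 1) x) 0 1

theorem det_shear {m : Type*} [Fintype m] [DecidableEq m] (x : m → ℝ) : (shear x).det = 1 := by
  simp [shear]

theorem shear_mulVec {m : Type*} [Fintype m] [DecidableEq m] (x y : m → ℝ) :
    shear x *ᵥ Sum.elim y 1 = Sum.elim (y + x) 1 := by
  rw [shear, fromBlocks_mulVec, Sum.elim_comp_inl, Sum.elim_comp_inr, one_mulVec, one_mulVec,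
    zero_mulVec, zero_add]
  congr 2
  ext j
  simp [mulVec, dotProduct]

theorem det_sum_vecMulVec_lift {ι m : Type*} [Fintype ι] [Fintype m] [DecidableEq m]
    (w : ι → ℝ) (a : ι → m → ℝ) (c : m → ℝ) (hc : ∑ i, w i • (a i - c) = 0) :
    (∑ i, w i • vecMulVec (Sum.elim (a i) (1 : Fin 1 → ℝ)) (Sum.elim (a i) 1)).det =
      (∑ i, w i • vecMulVec (a i - c) (a i - c)).det * ∑ i, w i := by
  have hblock : ∑ i, w i • vecMulVec (Sum.elim (a i - c) (1 : Fin 1 → ℝ)) (Sum.elim (a i - c) 1)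
      = fromBlocks (∑ i, w i • vecMulVec (a i - c) (a i - c)) 0 0
        (diagonal fun _ => ∑ i, w i) := by
    have h : ∀ j, ∑ i, w i * (a i j - c j) = 0 := fun j => by
      simpa using congrFun hc j
    ext j k
    rcases j with j | j <;> rcases k with k | k <;>
      simp [Matrix.sum_apply, vecMulVec_apply, h, Fin.fin_one_eq_zero]
  have hshear : ∑ i, w i • vecMulVec (Sum.elim (a i) (1 : Fin 1 → ℝ)) (Sum.elim (a i) 1) =
      shear c * (∑ i, w i • vecMulVec (Sum.elim (a i - c) (1 : Fin 1 → ℝ))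
        (Sum.elim (a i - c) 1)) * (shear c)ᵀ := by
    simp only [mul_sum_smul_vecMulVec_mul_transpose, shear_mulVec, sub_add_cancel]
  rw [hshear, hblock]
  simp [det_mul, det_transpose, det_shear]

/-- The matrix of the quadratic form `(x, t) ↦ (x - t y)ᵀ R (x - t y) + r t²`. -/
def liftedForm {m : Type*} [Fintype m] [DecidableEq m] (R : Matrix m m ℝ) (r : ℝ) (y : m → ℝ) :
    Matrix (m ⊕ Fin 1) (m ⊕ Fin 1) ℝ :=
  (shear (-y))ᵀ * fromBlocks R 0 0 (diagonal fun _ => r) * shear (-y)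

theorem det_liftedForm {m : Type*} [Fintype m] [DecidableEq m] (R : Matrix m m ℝ) (r : ℝ)
    (y : m → ℝ) : (liftedForm R r y).det = R.det * r := by
  simp [liftedForm, det_mul, det_transpose, det_shear]

theorem liftedForm_quadratic {m : Type*} [Fintype m] [DecidableEq m] (R : Matrix m m ℝ) (r : ℝ)
    (x y : m → ℝ) :
    Sum.elim x 1 ⬝ᵥ (liftedForm R r y *ᵥ Sum.elim x 1) = (x - y) ⬝ᵥ (R *ᵥ (x - y)) + r := by
  rw [liftedForm, ← mulVec_mulVec, ← mulVec_mulVec, dotProduct_mulVec, vecMul_transpose,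
    shear_mulVec, fromBlocks_mulVec, ← sub_eq_add_neg]
  simp [dotProduct]

theorem liftedForm_posDef {m : Type*} [Fintype m] [DecidableEq m] {R : Matrix m m ℝ}
    (hR : R.PosDef) {r : ℝ} (hr : 0 < r) (y : m → ℝ) : (liftedForm R r y).PosDef := by
  have hD : (fromBlocks R 0 0 (diagonal fun _ : Fin 1 => r)).PosDef := by
    refine .of_dotProduct_mulVec_pos ?_ fun x hx => ?_
    · exact hR.isHermitian.fromBlocks (by simp) (isHermitian_diagonal _)
    · obtain ⟨p, q, rfl⟩ : ∃ p q, x = Sum.elim p q := ⟨_, _, (Sum.elim_comp_inl_inr x).symm⟩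
      have hval : star (Sum.elim p q) ⬝ᵥ
          (fromBlocks R 0 0 (diagonal fun _ : Fin 1 => r) *ᵥ Sum.elim p q) =
          p ⬝ᵥ (R *ᵥ p) + r * q 0 ^ 2 := by
        simp [fromBlocks_mulVec, dotProduct]
        ring
      rw [hval]
      have hp0 : 0 ≤ p ⬝ᵥ (R *ᵥ p) := by simpa using hR.posSemidef.dotProduct_mulVec_nonneg p
      by_cases hp : p = 0
      · have hq : q 0 ≠ 0 := by
          contrapose! hx
          ext j
          rcases j with j | j
          · simp [hp]
          · simpa [Subsingleton.elim j 0] using hx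
        positivity
      · have : 0 < p ⬝ᵥ (R *ᵥ p) := by simpa using hR.dotProduct_mulVec_pos hp
        positivity
  have hunit : IsUnit (shear (-y)) := by
    rw [isUnit_iff_isUnit_det, det_shear]; exact isUnit_one
  have := hD.conjTranspose_mul_mul_same (mulVec_injective_of_isUnit hunit)
  simpa [liftedForm] using this

open Matrix Real Finset

/-- Arbitrary-center volume approximation lemma (Lemma 2.7). If all points lie within
distance `4β` of `c⋆`, the lifted dual weights `w` with `∑ w i = d + 1` satisfy
complementary slackness for `M̂ = ∑ w i • ã i ã iᵀ`, `S⁻¹ ⪯ I`, and the total weight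
on outliers (points with `(a i - c⋆)ᵀ S⁻¹ (a i - c⋆) > d/(d+1)`) is at most `γ (d+1)`,
then the centered second-moment matrix `M` satisfies
`log det M ≤ log det S + γ (d+1) log (17 β²)`. -/
theorem volume_approx_arbitrary_center
    (d n : ℕ) (hd : 0 < d) (hn : 0 < n)
    (β γ : ℝ) (hβ : 1 ≤ β) (hγ : 0 ≤ γ)
    (a : Fin n → Fin d → ℝ) (cstar : Fin d → ℝ)
    (ha : ∀ i, Real.sqrt ((a i - cstar) ⬝ᵥ (a i - cstar)) ≤ 4 * β)
    (w : Fin n → ℝ) (hw : ∀ i, 0 ≤ w i) (hsum : ∑ i, w i = (d : ℝ) + 1)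
    (ta : Fin n → Fin (d + 1) → ℝ) (hta : ∀ i, ta i = Fin.snoc (a i) 1)
    (Mhat : Matrix (Fin (d + 1)) (Fin (d + 1)) ℝ)
    (hMhat : Mhat = ∑ i, w i • Matrix.vecMulVec (ta i) (ta i))
    (hMhatpd : Mhat.PosDef)
    (hcs : ∀ i, 0 < w i → ta i ⬝ᵥ (Mhat⁻¹ *ᵥ ta i) = 1)
    (c : Fin d → ℝ) (hc : c = ((d : ℝ) + 1)⁻¹ • ∑ i, w i • a i)
    (M : Matrix (Fin d) (Fin d) ℝ)
    (hM : M = ∑ i, w i • Matrix.vecMulVec (a i - c) (a i - c))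
    (S : Matrix (Fin d) (Fin d) ℝ) (hS : S.PosDef)
    (hScond : ((1 : Matrix (Fin d) (Fin d) ℝ) - S⁻¹).PosSemidef)
    (hout : ∑ i ∈ Finset.univ.filter
        (fun i => ¬ ((a i - cstar) ⬝ᵥ (S⁻¹ *ᵥ (a i - cstar)) ≤ (d : ℝ) / ((d : ℝ) + 1))),
        w i ≤ γ * ((d : ℝ) + 1)) :
    Real.log M.det ≤ Real.log S.det + γ * ((d : ℝ) + 1) * Real.log (17 * β ^ 2) := by
  have hk : (0 : ℝ) < d + 1 := by positivity
  set e : Fin d ⊕ Fin 1 ≃ Fin (d + 1) := finSumFinEquiv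
  set u : Fin n → Fin d ⊕ Fin 1 → ℝ := fun i => Sum.elim (a i) 1 with hu
  have hue : ∀ i, ta i ∘ e = u i := by
    intro i
    ext j
    rw [hta, hu]
    rcases j with j | j
    · exact Fin.snoc_castSucc (α := fun _ => ℝ) (1 : ℝ) (a i) j
    · obtain rfl := Subsingleton.elim j 0
      exact Fin.snoc_last (α := fun _ => ℝ) (1 : ℝ) (a i)
  set A := Mhat.submatrix e e with hA
  have hApd : A.PosDef := hMhatpd.submatrix e.injective
  have hAu : A = ∑ i, w i • vecMulVec (u i) (u i) := by
    ext j k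
    simp [hA, hMhat, Matrix.sum_apply, vecMulVec_apply, ← hue]
  have hslack : ∀ i, 0 < w i → u i ⬝ᵥ (A⁻¹ *ᵥ u i) = 1 := by
    intro i hi
    rw [hA, inv_submatrix_equiv, submatrix_mulVec_equiv, ← hue, Function.comp_assoc,
      Equiv.self_comp_symm, Function.comp_id, comp_equiv_dotProduct_comp_equiv]
    exact hcs i hi
  have hdetA : A.det = M.det * ((d : ℝ) + 1) := by
    have hcent : ∑ i, w i • (a i - c) = 0 := by
      simp only [smul_sub, sum_sub_distrib, ← sum_smul]
      rw [hsum, hc, smul_inv_smul₀ hk.ne', sub_self]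
    rw [hAu, hM, ← hsum]
    exact det_sum_vecMulVec_lift w a c hcent
  have hMdet : 0 < M.det := pos_of_mul_pos_left (hdetA ▸ hApd.det_pos) hk.le
  have hquad : ∀ i, u i ⬝ᵥ (liftedForm S⁻¹ ((d : ℝ) + 1)⁻¹ cstar *ᵥ u i) =
      (a i - cstar) ⬝ᵥ (S⁻¹ *ᵥ (a i - cstar)) + ((d : ℝ) + 1)⁻¹ :=
    fun i => liftedForm_quadratic _ _ _ _
  have key := hApd.log_det_add_log_det_le_sum
    (liftedForm_posDef hS.inv (inv_pos.mpr hk) cstar) hw hAu hslack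
  rw [hdetA, det_liftedForm, det_nonsing_inv, Ring.inverse_eq_inv',
    log_mul hMdet.ne' hk.ne', log_mul (inv_pos.mpr hS.det_pos).ne' (inv_pos.mpr hk).ne',
    log_inv, log_inv] at key
  simp only [hquad] at key
  have hnonneg : ∀ i, 0 ≤ (a i - cstar) ⬝ᵥ (S⁻¹ *ᵥ (a i - cstar)) := fun i => by
    simpa using hS.inv.posSemidef.dotProduct_mulVec_nonneg (a i - cstar)
  have hupper : ∀ i, (a i - cstar) ⬝ᵥ (S⁻¹ *ᵥ (a i - cstar)) + ((d : ℝ) + 1)⁻¹ ≤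
      17 * β ^ 2 := by
    intro i
    have h1 : (a i - cstar) ⬝ᵥ (a i - cstar) ≤ (4 * β) ^ 2 :=
      (Real.sqrt_le_left (by positivity)).mp (ha i)
    have h2 := hScond.dotProduct_mulVec_nonneg (a i - cstar)
    rw [sub_mulVec, one_mulVec, dotProduct_sub, star_trivial] at h2
    have h3 : ((d : ℝ) + 1)⁻¹ ≤ 1 := inv_le_one_of_one_le₀ (by simp)
    nlinarith
  have hlog : 0 ≤ log (17 * β ^ 2) := log_nonneg (by nlinarith)
  have hbound : ∑ i, w i * log ((a i - cstar) ⬝ᵥ (S⁻¹ *ᵥ (a i - cstar)) + ((d : ℝ) + 1)⁻¹) ≤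
      γ * ((d : ℝ) + 1) * log (17 * β ^ 2) := by
    refine le_trans ?_ (mul_le_mul_of_nonneg_right hout hlog)
    rw [sum_mul, sum_filter]
    refine sum_le_sum fun i _ => ?_
    have hpos : 0 < (a i - cstar) ⬝ᵥ (S⁻¹ *ᵥ (a i - cstar)) + ((d : ℝ) + 1)⁻¹ :=
      add_pos_of_nonneg_of_pos (hnonneg i) (inv_pos.mpr hk)
    split_ifs with h
    · refine mul_nonpos_of_nonneg_of_nonpos (hw i) (log_nonpos hpos.le ?_)
      have h1 : (d : ℝ) / (d + 1) + ((d : ℝ) + 1)⁻¹ = 1 := by field_simp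
      linarith
    · exact mul_le_mul_of_nonneg_left (log_le_log hpos (hupper i)) (hw i)
  linarith
end

section
/- Let d, n be positive integers and a_1, …, a_n ∈ ℝ^d points that affinely span ℝ^d, with lifted points ã_i = (a_i, 1) ∈ ℝ^{d+1}. Consider the free-center dual program: maximize f(w) = det(∑_i w_i (a_i − c(w))(a_i − c(w))ᵀ) over w ∈ ℝ^n with w_i ≥ 0 and ∑_i w_i = d, where c(w) = (∑_i w_i a_i)/(∑_i w_i); and the lifted origin-centered dual program: maximize g(w̃) = det(∑_i w̃_i ã_i ã_iᵀ) over w̃ ∈ ℝ^n with w̃_i ≥ 0 and ∑_i w̃_i ≤ d+1. Then w is an optimal solution (maximizer) of the free-center dual program if and only if ((d+1)/d)·w is an optimal solution of the lifted origin-centered dual program. -/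
open Matrix Real

/-- The moment matrix of the lifted points `(a i, 1)` with weights `w`. -/
noncomputable def liftedMoment {d n : ℕ} (a : Fin n → Fin d → ℝ) (w : Fin n → ℝ) :
    Matrix (Fin (d + 1)) (Fin (d + 1)) ℝ :=
  ∑ i, w i • Matrix.vecMulVec (Fin.snoc (a i) 1 : Fin (d + 1) → ℝ)
    (Fin.snoc (a i) 1 : Fin (d + 1) → ℝ)

/-- The moment matrix of the points `a i` about their weighted mean. -/
noncomputable def centeredMoment {d n : ℕ} (a : Fin n → Fin d → ℝ) (w : Fin n → ℝ) :
    Matrix (Fin d) (Fin d) ℝ :=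
  ∑ i, w i • Matrix.vecMulVec (a i - (∑ j, w j)⁻¹ • ∑ j, w j • a j)
    (a i - (∑ j, w j)⁻¹ • ∑ j, w j • a j)

lemma centeredMoment_apply {d n : ℕ} (a : Fin n → Fin d → ℝ) (w : Fin n → ℝ)
    (hs : ∑ i, w i ≠ 0) (j k : Fin d) :
    centeredMoment a w j k = ∑ i, w i * (a i j * a i k) -
      (∑ i, w i * a i j) * (∑ i, w i)⁻¹ * ∑ i, w i * a i k := by
  simp only [centeredMoment, Matrix.sum_apply, Matrix.smul_apply, Matrix.vecMulVec_apply,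
    Pi.sub_apply, Pi.smul_apply, Finset.sum_apply, smul_eq_mul]
  set s := ∑ i, w i with hsdef
  set p := ∑ i, w i * a i j with hp
  set q := ∑ i, w i * a i k with hq
  have expand : ∀ i, w i * ((a i j - s⁻¹ * p) * (a i k - s⁻¹ * q)) =
      w i * (a i j * a i k) - s⁻¹ * q * (w i * a i j) - s⁻¹ * p * (w i * a i k)
        + s⁻¹ * p * (s⁻¹ * q) * w i := fun i => by ring
  simp only [expand, Finset.sum_add_distrib, Finset.sum_sub_distrib, ← Finset.mul_sum]
  rw [← hsdef, ← hp, ← hq]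
  field_simp
  ring

lemma det_liftedMoment {d n : ℕ} (a : Fin n → Fin d → ℝ) (w : Fin n → ℝ)
    (hs : ∑ i, w i ≠ 0) :
    (liftedMoment a w).det = (∑ i, w i) * (centeredMoment a w).det := by
  set s := ∑ i, w i with hsdef
  let D : Matrix (Fin 1) (Fin 1) ℝ := Matrix.of fun _ _ => s
  let E : Matrix (Fin 1) (Fin 1) ℝ := Matrix.of fun _ _ => s⁻¹
  let A : Matrix (Fin d) (Fin d) ℝ := Matrix.of fun j k => ∑ i, w i * (a i j * a i k)
  let B : Matrix (Fin d) (Fin 1) ℝ := Matrix.of fun j _ => ∑ i, w i * a i j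
  have hED : E * D = 1 := by
    ext i j
    rw [Subsingleton.elim i j, Matrix.one_apply_eq]
    simp [E, D, Matrix.mul_apply, hs]
  let : Invertible D := ⟨E, hED, mul_eq_one_comm.1 hED⟩
  have hblocks : (liftedMoment a w).submatrix finSumFinEquiv finSumFinEquiv =
      Matrix.fromBlocks A B Bᵀ D := by
    have hl : ∀ (x : Fin d → ℝ) (i : Fin d),
        (Fin.snoc x 1 : Fin (d + 1) → ℝ) (Fin.castAdd 1 i) = x i :=
      fun x i => Fin.snoc_castSucc (α := fun _ => ℝ) 1 x i
    have hr : ∀ (x : Fin d → ℝ) (i : Fin 1),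
        (Fin.snoc x 1 : Fin (d + 1) → ℝ) (Fin.natAdd d i) = 1 := by
      intro x i
      rw [Subsingleton.elim i 0]
      exact Fin.snoc_last (α := fun _ => ℝ) 1 x
    ext (i | i) (j | j) <;>
      simp [liftedMoment, Matrix.sum_apply, Matrix.vecMulVec_apply, A, B, D, hl, hr, hsdef]
  have hschur : A - B * ⅟D * Bᵀ = centeredMoment a w := by
    have hinv : ⅟D = E := rfl
    ext j k
    rw [centeredMoment_apply a w hs, hinv]
    simp [A, B, E, Matrix.mul_apply, ← hsdef]
  rw [← Matrix.det_submatrix_equiv_self finSumFinEquiv, hblocks, Matrix.det_fromBlocks₂₂, hschur]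
  simp [D]

lemma liftedMoment_smul {d n : ℕ} (a : Fin n → Fin d → ℝ) (w : Fin n → ℝ) (t : ℝ) :
    liftedMoment a (fun i => t * w i) = t • liftedMoment a w := by
  simp only [liftedMoment, Finset.smul_sum, smul_smul]

lemma det_liftedMoment_smul {d n : ℕ} (a : Fin n → Fin d → ℝ) (w : Fin n → ℝ) (t : ℝ) :
    (liftedMoment a (fun i => t * w i)).det = t ^ (d + 1) * (liftedMoment a w).det := by
  rw [liftedMoment_smul, Matrix.det_smul, Fintype.card_fin]

lemma liftedMoment_posSemidef {d n : ℕ} (a : Fin n → Fin d → ℝ) {w : Fin n → ℝ}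
    (hw : ∀ i, 0 ≤ w i) : (liftedMoment a w).PosSemidef := by
  refine Matrix.posSemidef_sum _ fun i _ => Matrix.PosSemidef.smul ?_ (hw i)
  simpa using Matrix.posSemidef_vecMulVec_self_star (Fin.snoc (a i) 1 : Fin (d + 1) → ℝ)

/-- An affine function vanishing on an affinely spanning family vanishes identically. -/
lemma eq_zero_of_dotProduct_lift_eq_zero {d n : ℕ} {a : Fin n → Fin d → ℝ}
    (hspan : affineSpan ℝ (Set.range a) = ⊤) {x : Fin (d + 1) → ℝ}
    (hx : ∀ i, (Fin.snoc (a i) 1 : Fin (d + 1) → ℝ) ⬝ᵥ x = 0) : x = 0 := by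
  let φ : (Fin d → ℝ) →ᵃ[ℝ] ℝ :=
    (Fintype.linearCombination ℝ (fun j : Fin d => x j.castSucc)).toAffineMap +
      AffineMap.const ℝ (Fin d → ℝ) (x (Fin.last d))
  have hφ : ∀ y, φ y = ∑ j, y j * x j.castSucc + x (Fin.last d) := fun y => by
    simp [φ, Fintype.linearCombination_apply]
  have hzero : φ = AffineMap.const ℝ (Fin d → ℝ) (0 : ℝ) := by
    refine AffineMap.ext_on hspan ?_
    rintro _ ⟨i, rfl⟩
    have h := hx i
    simp only [dotProduct, Fin.sum_univ_castSucc, Fin.snoc_castSucc, Fin.snoc_last,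
      one_mul] at h
    rw [hφ, h, AffineMap.const_apply]
  have hval : ∀ y : Fin d → ℝ, ∑ j, y j * x j.castSucc + x (Fin.last d) = 0 := fun y => by
    rw [← hφ, hzero, AffineMap.const_apply]
  have hlast : x (Fin.last d) = 0 := by simpa using hval 0
  ext j
  refine Fin.lastCases hlast (fun j => ?_) j
  simpa [hlast, Pi.single_apply] using hval (Pi.single j 1)

lemma det_liftedMoment_pos {d n : ℕ} {a : Fin n → Fin d → ℝ}
    (hspan : affineSpan ℝ (Set.range a) = ⊤) {w : Fin n → ℝ} (hw : ∀ i, 0 < w i) :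
    0 < (liftedMoment a w).det := by
  refine lt_of_le_of_ne (liftedMoment_posSemidef a fun i => (hw i).le).det_nonneg fun h => ?_
  obtain ⟨x, hx0, hx⟩ := Matrix.exists_mulVec_eq_zero_iff.2 h.symm
  refine hx0 (eq_zero_of_dotProduct_lift_eq_zero hspan ?_)
  have hquad : ∑ i, w i * ((Fin.snoc (a i) 1 : Fin (d + 1) → ℝ) ⬝ᵥ x) ^ 2 = 0 := by
    have h0 : x ⬝ᵥ (liftedMoment a w *ᵥ x) = 0 := by rw [hx, dotProduct_zero]
    rw [← h0, liftedMoment, Matrix.sum_mulVec, dotProduct_sum]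
    refine Finset.sum_congr rfl fun i _ => ?_
    rw [Matrix.smul_mulVec, Matrix.vecMulVec_mulVec, dotProduct_smul]
    simp [dotProduct_comm x, sq]
  intro i
  have hi := (Finset.sum_eq_zero_iff_of_nonneg
    fun i _ => mul_nonneg (hw i).le (sq_nonneg _)).1 hquad i (Finset.mem_univ i)
  simpa [(hw i).ne'] using hi

/-- Dual equivalence under the lift (Proposition B.1). For points `a 1, …, a n` affinely
spanning `ℝ^d`, `w` is an optimal solution of the free-center dual program
(maximize `det (∑ w i • (a i - c w)(a i - c w)ᵀ)` over `w ≥ 0`, `∑ w i = d`, where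
`c w = (∑ w i • a i)/(∑ w i)`) if and only if `((d+1)/d) • w` is an optimal solution
of the lifted origin-centered dual program (maximize `det (∑ w̃ i • ã i ã iᵀ)` over
`w̃ ≥ 0`, `∑ w̃ i ≤ d + 1`, where `ã i = (a i, 1)`). -/
theorem dual_equivalence_under_lift
    (d n : ℕ) (hd : 0 < d) (hn : 0 < n)
    (a : Fin n → Fin d → ℝ)
    (hspan : affineSpan ℝ (Set.range a) = ⊤)
    (f g : (Fin n → ℝ) → ℝ)
    (hf : ∀ w, f w = (∑ i, w i •
        Matrix.vecMulVec (a i - (∑ j, w j)⁻¹ • ∑ j, w j • a j)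
          (a i - (∑ j, w j)⁻¹ • ∑ j, w j • a j)).det)
    (hg : ∀ w, g w = (∑ i, w i •
        Matrix.vecMulVec (Fin.snoc (a i) 1 : Fin (d + 1) → ℝ)
          (Fin.snoc (a i) 1 : Fin (d + 1) → ℝ)).det)
    (w : Fin n → ℝ) :
    ((∀ i, 0 ≤ w i) ∧ (∑ i, w i = (d : ℝ)) ∧
        ∀ v : Fin n → ℝ, (∀ i, 0 ≤ v i) → (∑ i, v i = (d : ℝ)) → f v ≤ f w) ↔
    ((∀ i, 0 ≤ (((d : ℝ) + 1) / d) * w i) ∧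
        (∑ i, (((d : ℝ) + 1) / d) * w i ≤ (d : ℝ) + 1) ∧
        ∀ v : Fin n → ℝ, (∀ i, 0 ≤ v i) → (∑ i, v i ≤ (d : ℝ) + 1) →
          g v ≤ g (fun i => (((d : ℝ) + 1) / d) * w i)) := by
  have hd' : (0 : ℝ) < d := by exact_mod_cast hd
  have hF : ∀ v, f v = (centeredMoment a v).det := hf
  have hG : ∀ v, g v = (liftedMoment a v).det := hg
  have hκ : (0 : ℝ) < ((d : ℝ) + 1) / d := by positivity
  have hscale : ∀ (t : ℝ) (v : Fin n → ℝ), g (fun i => t * v i) = t ^ (d + 1) * g v :=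
    fun t v => by rw [hG, hG, det_liftedMoment_smul]
  have hfg : ∀ v : Fin n → ℝ, ∑ i, v i = (d : ℝ) → g v = d * f v := fun v hv => by
    rw [hG, hF, det_liftedMoment a v (hv ▸ hd'.ne'), hv]
  have hg0 : ∀ v : Fin n → ℝ, (∀ i, 0 ≤ v i) → 0 ≤ g v := fun v hv => by
    rw [hG]
    exact (liftedMoment_posSemidef a hv).det_nonneg
  constructor
  · rintro ⟨hw, hsum, hopt⟩
    refine ⟨fun i => mul_nonneg hκ.le (hw i), ?_, fun v hv hvs => ?_⟩
    · rw [← Finset.mul_sum, hsum, div_mul_cancel₀ _ hd'.ne']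
    rw [hscale]
    obtain hs | hs := (Finset.sum_nonneg fun i _ => hv i : 0 ≤ ∑ i, v i).eq_or_lt
    · have hv0 : v = fun i => 0 * w i := by
        ext i
        rw [zero_mul]
        exact (Finset.sum_eq_zero_iff_of_nonneg fun i _ => hv i).1 hs.symm i (Finset.mem_univ i)
      rw [hv0, hscale, zero_pow d.succ_ne_zero, zero_mul]
      exact mul_nonneg (by positivity) (hg0 w hw)
    · set s := ∑ i, v i with hsdef
      have hu : ∑ i, (d / s) * v i = (d : ℝ) := by
        rw [← Finset.mul_sum, ← hsdef, div_mul_cancel₀ _ hs.ne']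
      have hvu : v = fun i => (s / d) * ((d / s) * v i) := by
        ext i
        field_simp
      have hle : g (fun i => (d / s) * v i) ≤ g w := by
        rw [hfg _ hu, hfg _ hsum]
        exact mul_le_mul_of_nonneg_left
          (hopt _ (fun i => mul_nonneg (by positivity) (hv i)) hu) hd'.le
      rw [hvu, hscale]
      exact mul_le_mul (pow_le_pow_left₀ (by positivity)
        (div_le_div_of_nonneg_right hvs hd'.le) _) hle
        (hg0 _ fun i => mul_nonneg (by positivity) (hv i)) (by positivity)
  · rintro ⟨hw, hsum, hopt⟩
    have hw0 : ∀ i, 0 ≤ w i := fun i => nonneg_of_mul_nonneg_right (hw i) hκ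
    have hn' : (0 : ℝ) < n := by exact_mod_cast hn
    have hpos : 0 < g (fun i => (((d : ℝ) + 1) / d) * w i) := by
      have hunif : 0 < g (fun _ => ((d : ℝ) + 1) / n) := by
        rw [hG]
        exact det_liftedMoment_pos hspan fun _ => by positivity
      refine hunif.trans_le (hopt _ (fun _ => by positivity) (le_of_eq ?_))
      rw [Finset.sum_const, Finset.card_univ, Fintype.card_fin, nsmul_eq_mul]
      field_simp
    have hgw : 0 < g w := by
      rw [hscale] at hpos
      exact pos_of_mul_pos_right hpos (by positivity)
    have hspos : 0 < ∑ i, w i := by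
      refine lt_of_le_of_ne (Finset.sum_nonneg fun i _ => hw0 i) fun h => hgw.ne' ?_
      have hwz : w = fun i => 0 * w i := by
        ext i
        rw [zero_mul]
        exact (Finset.sum_eq_zero_iff_of_nonneg fun i _ => hw0 i).1 h.symm i (Finset.mem_univ i)
      rw [hwz, hscale, zero_pow d.succ_ne_zero, zero_mul]
    have hsle : ∑ i, w i ≤ d := by
      rw [← Finset.mul_sum, div_mul_eq_mul_div, div_le_iff₀ hd'] at hsum
      exact le_of_mul_le_mul_left hsum (by positivity)
    have hsd : ∑ i, w i = (d : ℝ) := by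
      refine le_antisymm hsle ?_
      have h := hopt (fun i => (((d : ℝ) + 1) / ∑ j, w j) * w i)
        (fun i => mul_nonneg (by positivity) (hw0 i))
        (by rw [← Finset.mul_sum, div_mul_cancel₀ _ hspos.ne'])
      rw [hscale, hscale] at h
      have h' := le_of_pow_le_pow_left₀ d.succ_ne_zero hκ.le (le_of_mul_le_mul_right h hgw)
      exact (div_le_div_iff_of_pos_left (by positivity) hspos hd').1 h'
    refine ⟨hw0, hsd, fun v hv hvs => ?_⟩
    have h := hopt (fun i => (((d : ℝ) + 1) / d) * v i)
      (fun i => mul_nonneg hκ.le (hv i))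
      (by rw [← Finset.mul_sum, hvs, div_mul_cancel₀ _ hd'.ne'])
    rw [hscale, hscale, hfg v hvs, hfg w hsd] at h
    exact le_of_mul_le_mul_left (le_of_mul_le_mul_left h (by positivity)) hd'
end

section
/- Let d, n be positive integers, ε > 0, and a'_1, …, a'_n ∈ ℝ^d. Suppose that for every unit vector u ∈ ℝ^d, the number of indices i ∈ [n] with ⟨a'_i, u⟩² ≤ ε²/(256 d) is at most n/5. Then for every d×d symmetric positive definite matrix M and every subset T ⊆ [n] with |T| ≥ 4n/5 such that (a'_i)ᵀ M⁻¹ a'_i ≤ 1 for all i ∈ T, the smallest eigenvalue of M satisfies λ_min(M) ≥ ε²/(256 d). -/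
open Matrix Real Finset

/-- If `u` is a unit eigenvector of a positive definite `M` with eigenvalue `l`, then the quadratic
form of `M⁻¹` at `x` dominates `⟨x, u⟩² / l`. -/
theorem Matrix.PosDef.sq_dotProduct_eigenvector_le {ι : Type*} [Fintype ι] [DecidableEq ι]
    {M : Matrix ι ι ℝ} (hM : M.PosDef) {u : ι → ℝ} {l : ℝ} (hl : 0 < l)
    (hMu : M *ᵥ u = l • u) (hu : u ⬝ᵥ u = 1) (x : ι → ℝ) :
    (x ⬝ᵥ u) ^ 2 ≤ l * (x ⬝ᵥ (M⁻¹ *ᵥ x)) := by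
  have hdet : IsUnit M.det := isUnit_iff_ne_zero.mpr hM.det_pos.ne'
  have hinv : M⁻¹ *ᵥ u = l⁻¹ • u := by
    have h : M⁻¹ *ᵥ (M *ᵥ u) = u := by
      rw [mulVec_mulVec, nonsing_inv_mul M hdet, one_mulVec]
    rw [hMu, mulVec_smul] at h
    rw [eq_inv_smul_iff₀ hl.ne', h]
  have hsymm : M⁻¹ᵀ = M⁻¹ := by
    simpa [conjTranspose_eq_transpose_of_trivial] using hM.inv.isHermitian.eq
  have hcross : u ⬝ᵥ (M⁻¹ *ᵥ x) = l⁻¹ * (x ⬝ᵥ u) := by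
    rw [dotProduct_mulVec, ← mulVec_transpose, hsymm, hinv, smul_dotProduct, smul_eq_mul,
      dotProduct_comm]
  have hnonneg : 0 ≤ (x - (x ⬝ᵥ u) • u) ⬝ᵥ (M⁻¹ *ᵥ (x - (x ⬝ᵥ u) • u)) := by
    simpa using hM.inv.posSemidef.dotProduct_mulVec_nonneg (x - (x ⬝ᵥ u) • u)
  simp only [mulVec_sub, mulVec_smul, hinv, sub_dotProduct, dotProduct_sub, smul_dotProduct,
    dotProduct_smul, hcross, hu, smul_eq_mul] at hnonneg
  have h : l⁻¹ * (x ⬝ᵥ u) ^ 2 ≤ x ⬝ᵥ (M⁻¹ *ᵥ x) := by linarith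
  rwa [inv_mul_le_iff₀ hl] at h

/-- Deterministic core of the fatness lemma (Lemma 3.2). If in every unit direction `u`
at most `n/5` of the points have `⟨a' i, u⟩² ≤ ε²/(256 d)`, then every positive definite
`M` whose ellipsoid `{x : xᵀ M⁻¹ x ≤ 1}` contains at least `4n/5` of the points has all
eigenvalues (in particular the smallest) at least `ε²/(256 d)`. -/
theorem ellipsoid_fat_of_anticoncentration
    (d n : ℕ) (hd : 0 < d) (hn : 0 < n) (ε : ℝ) (hε : 0 < ε)
    (a : Fin n → Fin d → ℝ)
    (hanti : ∀ u : Fin d → ℝ, (∑ j, u j ^ 2 = 1) →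
      ((Finset.univ.filter (fun i => (a i ⬝ᵥ u) ^ 2 ≤ ε ^ 2 / (256 * d))).card : ℝ)
        ≤ (n : ℝ) / 5) :
    ∀ (M : Matrix (Fin d) (Fin d) ℝ) (hM : M.PosDef) (T : Finset (Fin n)),
      (4 * (n : ℝ) / 5 ≤ (T.card : ℝ)) →
      (∀ i ∈ T, a i ⬝ᵥ (M⁻¹ *ᵥ a i) ≤ 1) →
      ∀ j : Fin d, ε ^ 2 / (256 * d) ≤ hM.isHermitian.eigenvalues j := by
  intro M hM T hT hmem j
  by_contra! hlt
  have hpos := hM.eigenvalues_pos j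
  set u : Fin d → ℝ := ⇑(hM.isHermitian.eigenvectorBasis j) with hu_def
  have hsum : ∑ k, u k ^ 2 = 1 := by
    rw [hu_def, ← EuclideanSpace.real_norm_sq_eq,
      hM.isHermitian.eigenvectorBasis.orthonormal.1 j, one_pow]
  have hu : u ⬝ᵥ u = 1 := by simpa [dotProduct, sq] using hsum
  have hsub : T ⊆ Finset.univ.filter (fun i => (a i ⬝ᵥ u) ^ 2 ≤ ε ^ 2 / (256 * d)) := by
    intro i hi
    have h := hM.sq_dotProduct_eigenvector_le hpos
      (hM.isHermitian.mulVec_eigenvectorBasis j) hu (a i)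
    exact Finset.mem_filter.mpr ⟨Finset.mem_univ i,
      (h.trans (mul_le_of_le_one_right hpos.le (hmem i hi))).trans hlt.le⟩
  have hcard : (T.card : ℝ) ≤ (n : ℝ) / 5 :=
    (Nat.cast_le.mpr (Finset.card_le_card hsub)).trans (hanti u hsum)
  have hn' : (0 : ℝ) < n := Nat.cast_pos.mpr hn
  linarith
end
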